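/- For any quantum relative entropy 𝐃 and density matrices ω, σ on ℂ^d with λ_min(ω) > ‖σ − ω‖_∞ (λ_min the smallest eigenvalue, ‖·‖_∞ the operator norm), one has D_max(ω∥σ) ≤ −log₂(1 − ‖σ − ω‖_∞ / λ_min(ω)); consequently 𝐃(ρ∥σ) − 𝐃(ρ∥ω) ≤ −log₂(1 − ‖σ − ω‖_∞ / λ_min(ω)) for every density matrix ρ. -/

import Mathlib

open scoped ENNReal Kronecker ComplexOrder Matrix
open Classical

/-- A density matrix: positive semidefinite with unit trace. -/
def IsDensity {n : Type} [Fintype n] (ρ : Matrix n n ℂ) : Prop :=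
  ρ.PosSemidef ∧ ρ.trace = 1

/-- The extension `id_m ⊗ Φ` of a map `Φ` on matrices, acting blockwise. -/
def cpExt {a b : Type} (Φ : Matrix a a ℂ → Matrix b b ℂ) (m : Type)
    (M : Matrix (m × a) (m × a) ℂ) : Matrix (m × b) (m × b) ℂ :=
  Matrix.of fun p q => Φ (Matrix.of fun k l => M (p.1, k) (q.1, l)) p.2 q.2

/-- A map on matrices is completely positive if every extension `id_m ⊗ Φ`
preserves positive semidefiniteness. -/
def IsCP {a b : Type} [Fintype a] [Fintype b] (Φ : Matrix a a ℂ → Matrix b b ℂ) : Prop :=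
  ∀ (m : Type) [Fintype m] (M : Matrix (m × a) (m × a) ℂ),
    M.PosSemidef → (cpExt Φ m M).PosSemidef

/-- A quantum channel: a linear, completely positive, trace-preserving map. -/
def IsCPTP {a b : Type} [Fintype a] [Fintype b] (Φ : Matrix a a ℂ → Matrix b b ℂ) : Prop :=
  (∀ (c : ℂ) (A B : Matrix a a ℂ), Φ (c • A + B) = c • Φ A + Φ B) ∧
    IsCP Φ ∧ ∀ A : Matrix a a ℂ, (Φ A).trace = A.trace

/-- The projector onto the support of a Hermitian matrix. -/
noncomputable def suppProj {n : Type} [Fintype n] [DecidableEq n]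
    (ρ : Matrix n n ℂ) : Matrix n n ℂ :=
  if h : ρ.IsHermitian then
    (h.eigenvectorUnitary : Matrix n n ℂ) *
      Matrix.diagonal (fun i => if h.eigenvalues i = 0 then (0 : ℂ) else 1) *
      (h.eigenvectorUnitary : Matrix n n ℂ)ᴴ
  else 0

/-- The min relative entropy `D_min(ρ‖σ) = -log₂ Tr[Π_ρ σ]` (with value `+∞` if
`Tr[Π_ρ σ] = 0`, i.e. if `ρ ⊥ σ`). -/
noncomputable def Dmin {n : Type} [Fintype n] [DecidableEq n]
    (ρ σ : Matrix n n ℂ) : ℝ≥0∞ :=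
  if ((suppProj ρ * σ).trace.re) = 0 then ∞
  else ENNReal.ofReal (- Real.logb 2 ((suppProj ρ * σ).trace.re))

/-- The max relative entropy `D_max(ρ‖σ) = log₂ min {t : tσ ≥ ρ}` (with value `+∞`
if no such `t` exists, i.e. if `supp ρ ⊄ supp σ`). -/
noncomputable def Dmax {n : Type} [Fintype n]
    (ρ σ : Matrix n n ℂ) : ℝ≥0∞ :=
  if ∃ t : ℝ, ((t : ℂ) • σ - ρ).PosSemidef then
    ENNReal.ofReal (Real.logb 2 (sInf {t : ℝ | ((t : ℂ) • σ - ρ).PosSemidef}))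
  else ∞

/-- The smallest eigenvalue of a Hermitian matrix (junk value `0` otherwise). -/
noncomputable def minEig {n : Type} [Fintype n] [DecidableEq n] (ω : Matrix n n ℂ) : ℝ :=
  if h : ω.IsHermitian then ⨅ i, h.eigenvalues i else 0

/-- The operator norm of a Hermitian matrix, i.e. the largest absolute value of an
eigenvalue (junk value `0` otherwise). -/
noncomputable def hermOpNorm {n : Type} [Fintype n] [DecidableEq n] (X : Matrix n n ℂ) : ℝ :=
  if h : X.IsHermitian then ⨆ i, |h.eigenvalues i| else 0

/-- The state of a classical bit with probability `s` of being `0`. -/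
noncomputable def bitState (s : ℝ) : Matrix (Fin 2) (Fin 2) ℂ :=
  Matrix.diagonal ![(s : ℂ), 1 - (s : ℂ)]

theorem isDensity_bitState {s : ℝ} (h0 : 0 ≤ s) (h1 : s ≤ 1) : IsDensity (bitState s) := by
  refine ⟨?_, ?_⟩
  · refine Matrix.PosSemidef.diagonal fun i => ?_
    fin_cases i
    · simpa using h0
    · simpa [← Complex.ofReal_one, ← Complex.ofReal_sub] using h1
  · simp [bitState, Matrix.trace_diagonal, Fin.sum_univ_two]

theorem IsDensity.kronecker {a b : Type} [Fintype a] [Fintype b]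
    {ρ : Matrix a a ℂ} {τ : Matrix b b ℂ} (hρ : IsDensity ρ) (hτ : IsDensity τ) :
    IsDensity (ρ ⊗ₖ τ) :=
  ⟨hρ.1.kronecker hτ.1, by rw [Matrix.trace_kronecker, hρ.2, hτ.2, one_mul]⟩

theorem IsCP.add {a b : Type} [Fintype a] [Fintype b] {Φ Ψ : Matrix a a ℂ → Matrix b b ℂ}
    (hΦ : IsCP Φ) (hΨ : IsCP Ψ) : IsCP fun A => Φ A + Ψ A := by
  intro m _ M hM
  exact (hΦ m M hM).add (hΨ m M hM)

theorem IsCP.sum {a b ι : Type} [Fintype a] [Fintype b] (s : Finset ι)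
    {Φ : ι → Matrix a a ℂ → Matrix b b ℂ} (hΦ : ∀ i, IsCP (Φ i)) :
    IsCP fun A => ∑ i ∈ s, Φ i A := by
  intro m _ M hM
  have h : cpExt (fun A => ∑ i ∈ s, Φ i A) m M = ∑ i ∈ s, cpExt (Φ i) m M := by
    ext p q
    simp [cpExt, Matrix.sum_apply]
  rw [h]
  exact Matrix.posSemidef_sum s fun i _ => hΦ i m M hM

theorem isCP_submatrix {a b : Type} [Fintype a] [Fintype b] (e : b → a) :
    IsCP fun A : Matrix a a ℂ => A.submatrix e e := by
  intro m _ M hM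
  exact hM.submatrix (Prod.map id e)

theorem isCP_entry_smul {a b : Type} [Fintype a] [Fintype b] (i : a)
    {τ : Matrix b b ℂ} (hτ : τ.PosSemidef) :
    IsCP fun A : Matrix a a ℂ => A i i • τ := by
  intro m _ M hM
  exact (hM.submatrix fun x => (x, i)).kronecker hτ

/-- Measuring in the standard basis and preparing `τ i` on outcome `i` is a channel. -/
theorem isCPTP_measure_prepare {a b : Type} [Fintype a] [Fintype b]
    {τ : a → Matrix b b ℂ} (hτ : ∀ i, IsDensity (τ i)) :
    IsCPTP fun A : Matrix a a ℂ => ∑ i, A i i • τ i := by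
  refine ⟨fun c A B => ?_, IsCP.sum _ fun i => isCP_entry_smul i (hτ i).1, fun A => ?_⟩
  · simp [add_smul, mul_smul, Finset.sum_add_distrib, Finset.smul_sum]
  · simp [Matrix.trace_sum, Matrix.trace_smul, (hτ _).2]
    rfl

/-- Keeping the system when the flag bit is `0` and replacing it by `τ` when the flag bit is `1`
is a channel. -/
theorem isCPTP_keep_or_replace {a : Type} [Fintype a] {τ : Matrix a a ℂ} (hτ : IsDensity τ) :
    IsCPTP fun A : Matrix (a × Fin 2) (a × Fin 2) ℂ =>
      A.submatrix (fun k => (k, 0)) (fun k => (k, 0)) + ∑ k, A (k, 1) (k, 1) • τ := by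
  refine ⟨fun c A B => ?_, (isCP_submatrix _).add (IsCP.sum _ fun k => isCP_entry_smul _ hτ.1),
    fun A => ?_⟩
  · simp [add_smul, mul_smul, Finset.sum_add_distrib, Finset.smul_sum, Matrix.submatrix_add,
      Matrix.submatrix_smul]
    abel
  · simp only [Matrix.trace_add, Matrix.trace_sum, Matrix.trace_smul, hτ.2, smul_eq_mul, mul_one]
    simp [Matrix.trace, Fintype.sum_prod_type, Finset.sum_add_distrib]

theorem exists_density_mixture {n : Type} [Fintype n] {α β : Matrix n n ℂ}
    (hα : IsDensity α) (hβ : IsDensity β) {s : ℝ} (h1 : s ≤ 1)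
    (h : (β - (s : ℂ) • α).PosSemidef) :
    ∃ τ, IsDensity τ ∧ β = (s : ℂ) • α + (1 - (s : ℂ)) • τ := by
  rcases h1.eq_or_lt with rfl | hs
  · refine ⟨α, hα, ?_⟩
    have htr : (β - ((1 : ℝ) : ℂ) • α).trace = 0 := by
      simp [Matrix.trace_sub, hα.2, hβ.2]
    have := h.trace_eq_zero_iff.mp htr
    simpa [sub_eq_zero] using this
  · have hpos : 0 < 1 - s := by linarith
    have hne : (1 - (s : ℂ)) ≠ 0 := by exact_mod_cast hpos.ne'
    refine ⟨(1 - (s : ℂ))⁻¹ • (β - (s : ℂ) • α), ⟨h.smul ?_, ?_⟩, ?_⟩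
    · have : (0 : ℝ) ≤ (1 - s)⁻¹ := by positivity
      exact_mod_cast this
    · simp [Matrix.trace_sub, Matrix.trace_smul, hα.2, hβ.2, hne]
    · rw [smul_inv_smul₀ hne]
      abel

theorem posSemidef_bitState_sub {s t r : ℝ} (h0 : t * r ≤ s) (h1 : t * (1 - r) ≤ 1 - s) :
    (bitState s - (t : ℂ) • bitState r).PosSemidef := by
  have : bitState s - (t : ℂ) • bitState r =
      Matrix.diagonal ![((s - t * r : ℝ) : ℂ), ((1 - s - t * (1 - r) : ℝ) : ℂ)] := by
    ext i j
    fin_cases i <;> fin_cases j <;> simp [bitState]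
  rw [this]
  refine Matrix.PosSemidef.diagonal fun i => ?_
  fin_cases i
  · exact Complex.zero_le_real.mpr (by linarith)
  · exact Complex.zero_le_real.mpr (by linarith)

section RelativeEntropy

variable (D : ∀ (m : Type) [Fintype m] [DecidableEq m], Matrix m m ℂ → Matrix m m ℂ → ℝ≥0∞)

/-- Monotonicity under quantum channels. -/
def DataProcessing : Prop :=
  ∀ (a b : Type) [Fintype a] [DecidableEq a] [Fintype b] [DecidableEq b]
    (Φ : Matrix a a ℂ → Matrix b b ℂ), IsCPTP Φ →
    ∀ ρ σ : Matrix a a ℂ, IsDensity ρ → IsDensity σ → D b (Φ ρ) (Φ σ) ≤ D a ρ σ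

/-- Additivity on tensor products of states. -/
def TensorAdditive : Prop :=
  ∀ (a b : Type) [Fintype a] [DecidableEq a] [Fintype b] [DecidableEq b]
    (ρ₁ σ₁ : Matrix a a ℂ) (ρ₂ σ₂ : Matrix b b ℂ),
    IsDensity ρ₁ → IsDensity σ₁ → IsDensity ρ₂ → IsDensity σ₂ →
    D (a × b) (ρ₁ ⊗ₖ ρ₂) (σ₁ ⊗ₖ σ₂) = D a ρ₁ σ₁ + D b ρ₂ σ₂

variable {D}

theorem DataProcessing.le_bitState (hdpi : DataProcessing D) {n : Type} [Fintype n] [DecidableEq n]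
    {α β : Matrix n n ℂ} (hα : IsDensity α) (hβ : IsDensity β) {s : ℝ} (h0 : 0 ≤ s) (h1 : s ≤ 1)
    (h : (β - (s : ℂ) • α).PosSemidef) :
    D n α β ≤ D (Fin 2) (bitState 1) (bitState s) := by
  obtain ⟨τ, hτ, hβτ⟩ := exists_density_mixture hα hβ h1 h
  have hprep : ∀ i, IsDensity (![α, τ] i) := by
    intro i
    fin_cases i
    · exact hα
    · exact hτ
  have := hdpi _ _ _ (isCPTP_measure_prepare hprep) _ _
    (isDensity_bitState zero_le_one le_rfl) (isDensity_bitState h0 h1)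
  convert this using 1
  congr 1
  · simp [bitState, Fin.sum_univ_two]
  · rw [hβτ]
    simp [bitState, Fin.sum_univ_two]

/-- The triangle inequality, with `D_max` in its operational form. -/
theorem DataProcessing.triangle (hdpi : DataProcessing D) (hadd : TensorAdditive D)
    {n : Type} [Fintype n] [DecidableEq n] {ρ ω σ : Matrix n n ℂ}
    (hρ : IsDensity ρ) (hω : IsDensity ω) (hσ : IsDensity σ) {s : ℝ} (h0 : 0 ≤ s) (h1 : s ≤ 1)
    (h : (σ - (s : ℂ) • ω).PosSemidef) :
    D n ρ σ ≤ D n ρ ω + D (Fin 2) (bitState 1) (bitState s) := by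
  obtain ⟨τ, hτ, hστ⟩ := exists_density_mixture hω hσ h1 h
  have hone := isDensity_bitState zero_le_one le_rfl
  have hs := isDensity_bitState h0 h1
  rw [← hadd _ _ _ _ _ _ hρ hω hone hs]
  have := hdpi _ _ _ (isCPTP_keep_or_replace hτ) _ _ (hρ.kronecker hone) (hω.kronecker hs)
  convert this using 1
  congr 1
  · ext i j
    simp [bitState]
  · rw [hστ, ← Finset.sum_smul]
    have htr : ∑ k, ω k k = 1 := hω.2
    ext i j
    simp [bitState, ← Finset.sum_mul, htr, mul_comm]

theorem DataProcessing.bitState_mul_le (hdpi : DataProcessing D) (hadd : TensorAdditive D)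
    {s t : ℝ} (hs0 : 0 ≤ s) (hs1 : s ≤ 1) (ht0 : 0 ≤ t) (ht1 : t ≤ 1) :
    D (Fin 2) (bitState 1) (bitState (s * t)) ≤
      D (Fin 2) (bitState 1) (bitState s) + D (Fin 2) (bitState 1) (bitState t) :=
  hdpi.triangle hadd (isDensity_bitState zero_le_one le_rfl) (isDensity_bitState hs0 hs1)
    (isDensity_bitState (by positivity) (mul_le_one₀ hs1 ht0 ht1)) ht0 ht1
    (posSemidef_bitState_sub (by linarith) (by linarith))

theorem DataProcessing.le_bitState_mul (hdpi : DataProcessing D) (hadd : TensorAdditive D)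
    {s t : ℝ} (hs0 : 0 ≤ s) (hs1 : s ≤ 1) (ht0 : 0 ≤ t) (ht1 : t ≤ 1) :
    D (Fin 2) (bitState 1) (bitState s) + D (Fin 2) (bitState 1) (bitState t) ≤
      D (Fin 2) (bitState 1) (bitState (s * t)) := by
  have hone := isDensity_bitState zero_le_one le_rfl
  have hs := isDensity_bitState hs0 hs1
  have ht := isDensity_bitState ht0 ht1
  rw [← hadd _ _ _ _ _ _ hone hs hone ht]
  refine hdpi.le_bitState (hone.kronecker hone) (hs.kronecker ht) (by positivity)
    (mul_le_one₀ hs1 ht0 ht1) ?_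
  have hsub : bitState s ⊗ₖ bitState t - ((s * t : ℝ) : ℂ) • bitState 1 ⊗ₖ bitState 1 =
      (bitState s - (s : ℂ) • bitState 1) ⊗ₖ bitState t +
        ((s : ℂ) • bitState 1) ⊗ₖ (bitState t - (t : ℂ) • bitState 1) := by
    ext i j
    simp [Matrix.kroneckerMap_apply]
    ring
  rw [hsub]
  refine ((posSemidef_bitState_sub ?_ ?_).kronecker ht.1).add
    ((hone.1.smul (Complex.zero_le_real.mpr hs0)).kronecker (posSemidef_bitState_sub ?_ ?_)) <;>
  linarith

theorem DataProcessing.nat_mul_bitState_le (hdpi : DataProcessing D) (hadd : TensorAdditive D)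
    {s : ℝ} (hs0 : 0 ≤ s) (hs1 : s ≤ 1) (n : ℕ) :
    ((n + 1 : ℕ) : ℝ≥0∞) * D (Fin 2) (bitState 1) (bitState s) ≤
      D (Fin 2) (bitState 1) (bitState (s ^ (n + 1))) := by
  induction n with
  | zero => simp
  | succ n ih =>
    rw [pow_succ, Nat.cast_succ, add_mul, one_mul]
    exact (add_le_add_left ih _).trans
      (hdpi.le_bitState_mul hadd (by positivity) (pow_le_one₀ hs0 hs1) hs0 hs1)

theorem DataProcessing.bitState_half_pow_le (hdpi : DataProcessing D) (hadd : TensorAdditive D)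
    (hnorm : D (Fin 2) (bitState 1) (bitState (1 / 2)) = 1) (n : ℕ) :
    D (Fin 2) (bitState 1) (bitState ((1 / 2) ^ (n + 1))) ≤ ((n + 1 : ℕ) : ℝ≥0∞) := by
  induction n with
  | zero => simpa using hnorm.le
  | succ n ih =>
    rw [pow_succ, Nat.cast_succ]
    refine (hdpi.bitState_mul_le hadd (by positivity) (pow_le_one₀ (by norm_num) (by norm_num))
      (by norm_num) (by norm_num)).trans ?_
    rw [hnorm]
    exact add_le_add_left ih 1

theorem DataProcessing.bitState_le_neg_logb (hdpi : DataProcessing D) (hadd : TensorAdditive D)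
    (hnorm : D (Fin 2) (bitState 1) (bitState (1 / 2)) = 1) {s : ℝ} (hs0 : 0 < s) (hs1 : s ≤ 1) :
    D (Fin 2) (bitState 1) (bitState s) ≤ ENNReal.ofReal (-Real.logb 2 s) := by
  set L := -Real.logb 2 s with hL
  have hL0 : 0 ≤ L := neg_nonneg.mpr (Real.logb_nonpos (by norm_num) hs0.le hs1)
  have hsL : s = (1 / 2 : ℝ) ^ L := by
    rw [one_div, Real.inv_rpow (by norm_num), ← Real.rpow_neg (by norm_num), hL, neg_neg,
      Real.rpow_logb (by norm_num) (by norm_num) hs0]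
  have hbound : ∀ n : ℕ, ((n + 1 : ℕ) : ℝ≥0∞) * D (Fin 2) (bitState 1) (bitState s) ≤
      ENNReal.ofReal ((n + 1 : ℕ) * L + 1) := by
    intro n
    set k := ⌊((n + 1 : ℕ) : ℝ) * L⌋₊ with hk
    have hpow : (1 / 2 : ℝ) ^ (k + 1) ≤ s ^ (n + 1) := by
      rw [hsL, ← Real.rpow_natCast, ← Real.rpow_natCast, ← Real.rpow_mul (by norm_num)]
      refine Real.rpow_le_rpow_of_exponent_ge (by norm_num) (by norm_num) ?_
      have := (Nat.lt_floor_add_one (((n + 1 : ℕ) : ℝ) * L)).le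
      rw [← hk] at this
      push_cast at this ⊢
      linarith
    have hk1 : (1 / 2 : ℝ) ^ (k + 1) ≤ 1 := pow_le_one₀ (by norm_num) (by norm_num)
    calc _ ≤ D (Fin 2) (bitState 1) (bitState (s ^ (n + 1))) :=
          hdpi.nat_mul_bitState_le hadd hs0.le hs1 n
      _ ≤ D (Fin 2) (bitState 1) (bitState ((1 / 2) ^ (k + 1))) :=
          hdpi.le_bitState (isDensity_bitState zero_le_one le_rfl)
            (isDensity_bitState (by positivity) (pow_le_one₀ hs0.le hs1)) (by positivity) hk1
            (posSemidef_bitState_sub (by linarith)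
              (by linarith [pow_le_one₀ (n := n + 1) hs0.le hs1]))
      _ ≤ ((k + 1 : ℕ) : ℝ≥0∞) := hdpi.bitState_half_pow_le hadd hnorm k
      _ ≤ _ := by
          rw [← ENNReal.ofReal_natCast]
          refine ENNReal.ofReal_le_ofReal ?_
          push_cast
          have := Nat.floor_le (a := ((n + 1 : ℕ) : ℝ) * L) (by positivity)
          rw [← hk] at this
          push_cast at this
          linarith
  have hfin : D (Fin 2) (bitState 1) (bitState s) ≠ ∞ := by
    have h := hbound 0
    rw [zero_add, Nat.cast_one, one_mul] at h
    exact ne_top_of_le_ne_top ENNReal.ofReal_ne_top h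
  refine ENNReal.le_ofReal_iff_toReal_le hfin hL0 |>.mpr ?_
  by_contra! hlt
  obtain ⟨n, hn⟩ := exists_nat_gt (1 / ((D (Fin 2) (bitState 1) (bitState s)).toReal - L))
  have h := ENNReal.toReal_mono ENNReal.ofReal_ne_top (hbound n)
  rw [ENNReal.toReal_mul, ENNReal.toReal_natCast, ENNReal.toReal_ofReal (by positivity)] at h
  rw [div_lt_iff₀ (sub_pos.mpr hlt)] at hn
  push_cast at h
  nlinarith

end RelativeEntropy

theorem Matrix.IsHermitian.posSemidef_sub_smul_one {n : Type} [Fintype n] [DecidableEq n]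
    {A : Matrix n n ℂ} (hA : A.IsHermitian) {c : ℝ} (hc : ∀ i, c ≤ hA.eigenvalues i) :
    (A - (c : ℂ) • (1 : Matrix n n ℂ)).PosSemidef := by
  have hU : (hA.eigenvectorUnitary : Matrix n n ℂ) * (hA.eigenvectorUnitary : Matrix n n ℂ)ᴴ = 1 :=
    Matrix.mem_unitaryGroup_iff.mp hA.eigenvectorUnitary.2
  have hspec : A = (hA.eigenvectorUnitary : Matrix n n ℂ) *
      Matrix.diagonal (fun i => (hA.eigenvalues i : ℂ)) *
        (hA.eigenvectorUnitary : Matrix n n ℂ)ᴴ := hA.spectral_theorem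
  have hsub : A - (c : ℂ) • (1 : Matrix n n ℂ) = (hA.eigenvectorUnitary : Matrix n n ℂ) *
      Matrix.diagonal (fun i => ((hA.eigenvalues i - c : ℝ) : ℂ)) *
        (hA.eigenvectorUnitary : Matrix n n ℂ)ᴴ := by
    have hdiag : Matrix.diagonal (fun i => ((hA.eigenvalues i - c : ℝ) : ℂ)) =
        Matrix.diagonal (fun i => (hA.eigenvalues i : ℂ)) - (c : ℂ) • (1 : Matrix n n ℂ) := by
      rw [Matrix.smul_one_eq_diagonal, Matrix.diagonal_sub]
      simp
    rw [hdiag, mul_sub, sub_mul, ← hspec, mul_smul_comm, mul_one, smul_mul_assoc, hU]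
  rw [hsub]
  exact (Matrix.PosSemidef.diagonal fun i =>
    Complex.zero_le_real.mpr (sub_nonneg.mpr (hc i))).mul_mul_conjTranspose_same _

theorem posSemidef_sub_minEig_smul_one {n : Type} [Fintype n] [DecidableEq n]
    {A : Matrix n n ℂ} (hA : A.IsHermitian) :
    (A - (minEig A : ℂ) • (1 : Matrix n n ℂ)).PosSemidef := by
  refine hA.posSemidef_sub_smul_one fun i => ?_
  rw [minEig, dif_pos hA]
  exact ciInf_le (Set.finite_range _).bddBelow i

theorem posSemidef_add_hermOpNorm_smul_one {n : Type} [Fintype n] [DecidableEq n]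
    {A : Matrix n n ℂ} (hA : A.IsHermitian) :
    (A + (hermOpNorm A : ℂ) • (1 : Matrix n n ℂ)).PosSemidef := by
  have h := hA.posSemidef_sub_smul_one (c := -hermOpNorm A) fun i => by
    rw [hermOpNorm, dif_pos hA, neg_le]
    exact (neg_le_abs _).trans
      (le_ciSup (f := fun i => |hA.eigenvalues i|) (Set.finite_range _).bddAbove i)
  simpa using h

theorem hermOpNorm_nonneg {n : Type} [Fintype n] [DecidableEq n] (A : Matrix n n ℂ) :
    0 ≤ hermOpNorm A := by
  unfold hermOpNorm
  split_ifs
  · exact Real.iSup_nonneg fun i => abs_nonneg _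
  · exact le_rfl

theorem posSemidef_sub_smul_of_hermOpNorm_lt {n : Type} [Fintype n] [DecidableEq n]
    {ω σ : Matrix n n ℂ} (hω : ω.IsHermitian) (hσ : σ.IsHermitian)
    (hgap : hermOpNorm (σ - ω) < minEig ω) :
    (σ - ((1 - hermOpNorm (σ - ω) / minEig ω : ℝ) : ℂ) • ω).PosSemidef := by
  have hδ := hermOpNorm_nonneg (σ - ω)
  have hlam := hδ.trans_lt hgap
  have hne : (minEig ω : ℂ) ≠ 0 := by exact_mod_cast hlam.ne'
  have hsum := (posSemidef_add_hermOpNorm_smul_one (hσ.sub hω)).add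
    ((posSemidef_sub_minEig_smul_one hω).smul
      (Complex.zero_le_real.mpr (div_nonneg hδ hlam.le)))
  convert hsum using 1
  rw [smul_sub, smul_smul, Complex.ofReal_div, div_mul_cancel₀ _ hne, Complex.ofReal_sub,
    Complex.ofReal_one, Complex.ofReal_div, sub_smul, one_smul]
  abel

theorem Dmax_le_neg_logb {n : Type} [Fintype n] {ω σ : Matrix n n ℂ}
    (hω : IsDensity ω) (hσ : IsDensity σ) {s : ℝ} (hs : 0 < s)
    (h : (σ - (s : ℂ) • ω).PosSemidef) :
    Dmax ω σ ≤ ENNReal.ofReal (-Real.logb 2 s) := by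
  have hmem : ((s⁻¹ : ℝ) : ℂ) • σ - ω = ((s⁻¹ : ℝ) : ℂ) • (σ - (s : ℂ) • ω) := by
    have hne : (s : ℂ) ≠ 0 := by exact_mod_cast hs.ne'
    rw [smul_sub, smul_smul, Complex.ofReal_inv, inv_mul_cancel₀ hne, one_smul]
  have hpsd : (((s⁻¹ : ℝ) : ℂ) • σ - ω).PosSemidef :=
    hmem ▸ h.smul (Complex.zero_le_real.mpr (inv_nonneg.mpr hs.le))
  have hlower : ∀ t ∈ {t : ℝ | ((t : ℂ) • σ - ω).PosSemidef}, 1 ≤ t := by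
    intro t ht
    have htr := Matrix.PosSemidef.trace_nonneg ht
    rw [Matrix.trace_sub, Matrix.trace_smul, hσ.2, hω.2, smul_eq_mul, mul_one] at htr
    exact_mod_cast sub_nonneg.mp htr
  rw [Dmax, if_pos ⟨_, hpsd⟩]
  refine ENNReal.ofReal_le_ofReal ?_
  rw [← Real.logb_inv]
  exact Real.logb_le_logb_of_le (by norm_num)
    (zero_lt_one.trans_le (le_csInf ⟨_, hpsd⟩ hlower)) (csInf_le ⟨1, hlower⟩ hpsd)

/-- If `λ_min(ω) > ‖σ - ω‖_∞` then `D_max(ω‖σ) ≤ -log₂(1 - ‖σ-ω‖_∞/λ_min(ω))`, and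
consequently any quantum relative entropy satisfies
`𝐃(ρ‖σ) ≤ 𝐃(ρ‖ω) - log₂(1 - ‖σ-ω‖_∞/λ_min(ω))` for every density matrix `ρ`. -/
theorem stmt8
    (D : ∀ (m : Type) [Fintype m] [DecidableEq m],
      Matrix m m ℂ → Matrix m m ℂ → ℝ≥0∞)
    -- data-processing inequality under quantum channels
    (hdpi : ∀ (a b : Type) [Fintype a] [DecidableEq a] [Fintype b] [DecidableEq b]
      (Φ : Matrix a a ℂ → Matrix b b ℂ), IsCPTP Φ →
      ∀ ρ σ : Matrix a a ℂ, IsDensity ρ → IsDensity σ → D b (Φ ρ) (Φ σ) ≤ D a ρ σ)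
    -- additivity under tensor products
    (hadd : ∀ (a b : Type) [Fintype a] [DecidableEq a] [Fintype b] [DecidableEq b]
      (ρ₁ σ₁ : Matrix a a ℂ) (ρ₂ σ₂ : Matrix b b ℂ),
      IsDensity ρ₁ → IsDensity σ₁ → IsDensity ρ₂ → IsDensity σ₂ →
      D (a × b) (ρ₁ ⊗ₖ ρ₂) (σ₁ ⊗ₖ σ₂) = D a ρ₁ σ₁ + D b ρ₂ σ₂)
    -- normalization
    (hnorm : D (Fin 2) (Matrix.diagonal ![1, 0]) (Matrix.diagonal ![1/2, 1/2]) = 1)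
    (d : ℕ) (hd : 0 < d) (ω σ : Matrix (Fin d) (Fin d) ℂ)
    (hω : IsDensity ω) (hσ : IsDensity σ)
    (hgap : hermOpNorm (σ - ω) < minEig ω) :
    Dmax ω σ ≤ ENNReal.ofReal (- Real.logb 2 (1 - hermOpNorm (σ - ω) / minEig ω)) ∧
    ∀ ρ : Matrix (Fin d) (Fin d) ℂ, IsDensity ρ →
      D (Fin d) ρ σ ≤ D (Fin d) ρ ω +
        ENNReal.ofReal (- Real.logb 2 (1 - hermOpNorm (σ - ω) / minEig ω)) := by
  have hδ := hermOpNorm_nonneg (σ - ω)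
  have hlam := hδ.trans_lt hgap
  have hs0 : 0 < 1 - hermOpNorm (σ - ω) / minEig ω := sub_pos.mpr ((div_lt_one hlam).mpr hgap)
  have hs1 : 1 - hermOpNorm (σ - ω) / minEig ω ≤ 1 := sub_le_self _ (div_nonneg hδ hlam.le)
  have hpsd := posSemidef_sub_smul_of_hermOpNorm_lt hω.1.1 hσ.1.1 hgap
  have hdp : DataProcessing D := hdpi
  have hbit : D (Fin 2) (bitState 1) (bitState (1 / 2)) = 1 := by
    convert hnorm using 3
    · simp [bitState]
    · norm_num [bitState]
  exact ⟨Dmax_le_neg_logb hω hσ hs0 hpsd, fun ρ hρ =>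
    (hdp.triangle hadd hρ hω hσ hs0.le hs1 hpsd).trans
      (add_le_add_right (hdp.bitState_le_neg_logb hadd hbit hs0 hs1) _)⟩
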